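/- arXiv:2512.23281 — 4 statements merged into one kernel-verified Lean document; each statement's English description precedes it below -/
import Mathlib

section
/- Identify the Heisenberg group ℍ¹ with ℝ³ via the group law (x,y,z)·(x′,y′,z′) = (x+x′, y+y′, z+z′+x′y), and fix an integer k ≥ 1 and real numbers a, b. Then the following are equivalent: (i) for every continuously differentiable curve γ = (γ₁,γ₂,γ₃) : [0,1] → ℝ³ which is horizontal, i.e. γ₃′(t) = γ₂(t) γ₁′(t) for all t ∈ [0,1], and which closes up modulo Γ_k, i.e. γ(1) = g·γ(0) for some g ∈ Γ_k = {(k n₁, n₂, n₃) : n₁,n₂,n₃ ∈ ℤ}, the flux ∫₀¹ (a γ₁′(t) + b γ₂′(t)) dt belongs to 2πℤ; (ii) a ∈ (2π/k)ℤ and b ∈ 2πℤ. -/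
/-- **Flux lattice on the Heisenberg nilmanifold `Γ_k \ ℍ¹`.**
Identify `ℍ¹ ≃ ℝ³` with group law `(x,y,z)·(x',y',z') = (x+x', y+y', z+z'+x'y)` and
let `Γ_k = {(k n₁, n₂, n₃) : n₁,n₂,n₃ ∈ ℤ}`, `k ≥ 1`.  For `a, b ∈ ℝ` the following
are equivalent: (i) for every `C¹` curve `γ = (γ₁,γ₂,γ₃) : [0,1] → ℝ³` which is
horizontal (`γ₃' = γ₂ γ₁'` on `[0,1]`) and closes up modulo `Γ_k`
(`γ(1) = g · γ(0)` for some `g ∈ Γ_k`), the flux `∫₀¹ (a γ₁' + b γ₂')` lies in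
`2πℤ`; (ii) `a ∈ (2π/k)ℤ` and `b ∈ 2πℤ`. -/
theorem heisenberg_flux_lattice (k : ℕ) (hk : 1 ≤ k) (a b : ℝ) :
    (∀ γ₁ γ₂ γ₃ : ℝ → ℝ,
      ContDiff ℝ 1 γ₁ → ContDiff ℝ 1 γ₂ → ContDiff ℝ 1 γ₃ →
      (∀ t ∈ Set.Icc (0 : ℝ) 1, deriv γ₃ t = γ₂ t * deriv γ₁ t) →
      (∃ n₁ n₂ n₃ : ℤ,
        γ₁ 1 = (k : ℝ) * n₁ + γ₁ 0 ∧
        γ₂ 1 = (n₂ : ℝ) + γ₂ 0 ∧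
        γ₃ 1 = (n₃ : ℝ) + γ₃ 0 + γ₁ 0 * n₂) →
      ∃ n : ℤ, (∫ t in (0 : ℝ)..1, (a * deriv γ₁ t + b * deriv γ₂ t))
        = 2 * Real.pi * n)
    ↔ ((∃ m : ℤ, a = 2 * Real.pi / k * m) ∧ (∃ m : ℤ, b = 2 * Real.pi * m)) := by
  have hk0 : (k : ℝ) ≠ 0 := Nat.cast_ne_zero.mpr (by omega)
  constructor
  · intro h
    constructor
    · obtain ⟨n, hn⟩ := h (fun t => k * t) (fun _ => 0) (fun _ => 0) (by fun_prop) (by fun_prop)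
        (by fun_prop) (by simp) ⟨1, 0, 0, by simp⟩
      refine ⟨n, ?_⟩
      have hd : ∀ t : ℝ, deriv (fun t : ℝ => (k : ℝ) * t) t = k := fun t => by simp
      simp only [hd, deriv_const, mul_zero, add_zero, intervalIntegral.integral_const, sub_zero,
        one_smul] at hn
      field_simp
      linarith
    · obtain ⟨n, hn⟩ := h (fun _ => 0) (fun t => t) (fun _ => 0) (by fun_prop) (by fun_prop)
        (by fun_prop) (by simp) ⟨0, 1, 0, by simp⟩
      exact ⟨n, by simpa using hn⟩
  · rintro ⟨⟨p, rfl⟩, ⟨q, rfl⟩⟩ γ₁ γ₂ γ₃ h₁ h₂ - - ⟨n₁, n₂, n₃, e₁, e₂, -⟩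
    refine ⟨p * n₁ + q * n₂, ?_⟩
    have i₁ : IntervalIntegrable (deriv γ₁) MeasureTheory.volume 0 1 :=
      (h₁.continuous_deriv le_rfl).intervalIntegrable _ _
    have i₂ : IntervalIntegrable (deriv γ₂) MeasureTheory.volume 0 1 :=
      (h₂.continuous_deriv le_rfl).intervalIntegrable _ _
    rw [intervalIntegral.integral_add (i₁.const_mul _) (i₂.const_mul _),
      intervalIntegral.integral_const_mul, intervalIntegral.integral_const_mul,
      intervalIntegral.integral_deriv_eq_sub
        (fun t _ => (h₁.differentiable one_ne_zero).differentiableAt) i₁,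
      intervalIntegral.integral_deriv_eq_sub
        (fun t _ => (h₂.differentiable one_ne_zero).differentiableAt) i₂, e₁, e₂]
    push_cast
    field_simp
    ring
end

section
/- Identify the Heisenberg group ℍ¹ with ℝ³ via the group law (x,y,z)·(x′,y′,z′) = (x+x′, y+y′, z+z′+x′y), fix an integer k ≥ 1 and real numbers a, b, and call φ : ℝ³ → ℂ Γ_k-invariant if φ(g·p) = φ(p) for all g ∈ Γ_k = {(k n₁, n₂, n₃) : n₁,n₂,n₃ ∈ ℤ} (equivalently φ(x+k,y,z) = φ(x,y+1,z+x) = φ(x,y,z+1) = φ(x,y,z)). Then there exists a smooth Γ_k-invariant φ : ℝ³ → ℂ, not identically zero, satisfying X φ + i a φ = 0 and Y φ + i b φ = 0 everywhere (where X φ = ∂_x φ + y ∂_z φ and Y φ = ∂_y φ) if and only if a ∈ (2π/k)ℤ and b ∈ 2πℤ. -/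
/-- The horizontal vector field `X = ∂_x + y ∂_z` on the Heisenberg group `ℝ³`,
applied to a function `φ : ℝ³ → ℂ`. -/
noncomputable def heisX (φ : ℝ × ℝ × ℝ → ℂ) (p : ℝ × ℝ × ℝ) : ℂ :=
  fderiv ℝ φ p (1, 0, 0) + p.2.1 • fderiv ℝ φ p (0, 0, 1)

/-- The horizontal vector field `Y = ∂_y` on the Heisenberg group `ℝ³`,
applied to a function `φ : ℝ³ → ℂ`. -/
noncomputable def heisY (φ : ℝ × ℝ × ℝ → ℂ) (p : ℝ × ℝ × ℝ) : ℂ :=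
  fderiv ℝ φ p (0, 1, 0)

/-- A function on a real normed space whose derivative along the line `p + s v` is `-i c` times
the function is an exponential along that line. -/
theorem apply_add_smul_of_fderiv_eq {E : Type*} [NormedAddCommGroup E] [NormedSpace ℝ E]
    {φ : E → ℂ} (hφ : Differentiable ℝ φ) (p v : E) (c : ℝ)
    (h : ∀ s : ℝ, fderiv ℝ φ (p + s • v) v + Complex.I * (c : ℂ) * φ (p + s • v) = 0) (s : ℝ) :
    φ (p + s • v) = Complex.exp (-(Complex.I * c * s)) * φ p := by
  have hd : ∀ t : ℝ, HasDerivAt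
      (fun t : ℝ => Complex.exp (Complex.I * c * t) * φ (p + t • v)) 0 t := by
    intro t
    have h1 : HasDerivAt (fun t : ℝ => p + t • v) v t := by
      simpa using ((hasDerivAt_id t).smul_const v).const_add p
    have h2 := (hφ (p + t • v)).hasFDerivAt.comp_hasDerivAt t h1
    have h3 : HasDerivAt (fun t : ℝ => Complex.exp (Complex.I * c * t))
        (Complex.exp (Complex.I * c * t) * (Complex.I * c)) t := by
      simpa using ((Complex.ofRealCLM.hasDerivAt (x := t)).const_mul (Complex.I * (c : ℂ))).cexp
    refine (h3.mul h2).congr_deriv ?_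
    simp only [Function.comp_apply]
    linear_combination Complex.exp (Complex.I * c * t) * h t
  have hc := is_const_of_deriv_eq_zero (fun t => (hd t).differentiableAt)
    (fun t => (hd t).deriv) s 0
  simp only [Complex.ofReal_zero, mul_zero, Complex.exp_zero, one_mul, zero_smul, add_zero] at hc
  rw [← hc, ← mul_assoc, ← Complex.exp_add, neg_add_cancel, Complex.exp_zero, one_mul]

theorem heisX_eq_fderiv (φ : ℝ × ℝ × ℝ → ℂ) (p : ℝ × ℝ × ℝ) :
    heisX φ p = fderiv ℝ φ p (1, 0, p.2.1) := by
  rw [heisX, ← map_smul, ← map_add]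
  simp

/-- The flow of `X` multiplies a solution of `X φ + i a φ = 0` by a phase. -/
theorem apply_flow_heisX {φ : ℝ × ℝ × ℝ → ℂ} (hφ : Differentiable ℝ φ) {a : ℝ}
    (h : ∀ p, heisX φ p + Complex.I * (a : ℂ) * φ p = 0) (x y z s : ℝ) :
    φ (x + s, y, z + s * y) = Complex.exp (-(Complex.I * a * s)) * φ (x, y, z) := by
  have := apply_add_smul_of_fderiv_eq hφ (x, y, z) (1, 0, y) a
    (fun s => by simpa [heisX_eq_fderiv] using h (x + s, y, z + s * y)) s
  simpa using this

/-- The flow of `Y` multiplies a solution of `Y φ + i b φ = 0` by a phase. -/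
theorem apply_flow_heisY {φ : ℝ × ℝ × ℝ → ℂ} (hφ : Differentiable ℝ φ) {b : ℝ}
    (h : ∀ p, heisY φ p + Complex.I * (b : ℂ) * φ p = 0) (x y z s : ℝ) :
    φ (x, y + s, z) = Complex.exp (-(Complex.I * b * s)) * φ (x, y, z) := by
  have := apply_add_smul_of_fderiv_eq hφ (x, y, z) (0, 1, 0) b
    (fun s => h ((x, y, z) + s • (0, 1, 0))) s
  simpa using this

/-- A horizontal zero mode does not depend on the central coordinate: the commutator of the
flows of `X` and `Y` is the translation in `z`, and the phases cancel. -/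
theorem apply_central_translation {φ : ℝ × ℝ × ℝ → ℂ} (hφ : Differentiable ℝ φ) {a b : ℝ}
    (hX : ∀ p, heisX φ p + Complex.I * (a : ℂ) * φ p = 0)
    (hY : ∀ p, heisY φ p + Complex.I * (b : ℂ) * φ p = 0) (x y z t : ℝ) :
    φ (x, y, z + t) = φ (x, y, z) := by
  have h1 := apply_flow_heisX hφ hX x (y + 1) z t
  rw [apply_flow_heisY hφ hY, apply_flow_heisY hφ hY,
    show z + t * (y + 1) = (z + t) + t * y by ring, apply_flow_heisX hφ hX,
    mul_left_comm] at h1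
  exact mul_left_cancel₀ (Complex.exp_ne_zero _) (mul_left_cancel₀ (Complex.exp_ne_zero _) h1)

theorem exists_int_of_exp_neg_I_mul_eq_one {c : ℝ}
    (h : Complex.exp (-(Complex.I * c)) = 1) : ∃ m : ℤ, c = 2 * Real.pi * m := by
  obtain ⟨n, hn⟩ := Complex.exp_eq_one_iff.1 h
  refine ⟨-n, ?_⟩
  have : (c : ℂ) = ((2 * Real.pi * (-n : ℤ) : ℝ) : ℂ) := by
    push_cast
    linear_combination Complex.I * hn + (c + 2 * Real.pi * n) * Complex.I_sq
  exact_mod_cast this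

/-- The zero mode `e^{-i(ax+by)}`. -/
noncomputable def heisZeroMode (a b : ℝ) (p : ℝ × ℝ × ℝ) : ℂ :=
  Complex.exp (-Complex.I * ((a * p.1 + b * p.2.1 : ℝ) : ℂ))

theorem contDiff_heisZeroMode (a b : ℝ) : ContDiff ℝ (⊤ : ℕ∞) (heisZeroMode a b) := by
  have h : ContDiff ℝ (⊤ : ℕ∞) fun p : ℝ × ℝ × ℝ => a * p.1 + b * p.2.1 := by fun_prop
  exact (contDiff_const.mul (Complex.ofRealCLM.contDiff.comp h)).cexp

theorem fderiv_heisZeroMode (a b : ℝ) (p v : ℝ × ℝ × ℝ) :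
    fderiv ℝ (heisZeroMode a b) p v =
      -Complex.I * (a * v.1 + b * v.2.1) * heisZeroMode a b p := by
  let L : ℝ × ℝ × ℝ →L[ℝ] ℂ := Complex.ofRealCLM.comp
    (a • ContinuousLinearMap.fst ℝ ℝ (ℝ × ℝ) +
      b • (ContinuousLinearMap.fst ℝ ℝ ℝ).comp (ContinuousLinearMap.snd ℝ ℝ (ℝ × ℝ)))
  have h : HasFDerivAt (heisZeroMode a b) _ p :=
    ((L.hasFDerivAt (x := p)).const_mul (-Complex.I)).cexp
  rw [h.fderiv]
  simp [L, heisZeroMode]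
  ring

theorem heisZeroMode_add_period {a b : ℝ} {p q : ℝ × ℝ × ℝ} (n : ℤ)
    (h : a * p.1 + b * p.2.1 = a * q.1 + b * q.2.1 + 2 * Real.pi * n) :
    heisZeroMode a b p = heisZeroMode a b q := by
  rw [heisZeroMode, heisZeroMode, h, Complex.exp_eq_exp_iff_exists_int]
  exact ⟨-n, by push_cast; ring⟩

/-- **Zero modes of the magnetic horizontal Laplacian on `Γ_k \ ℍ¹`.**
There exists a smooth `Γ_k`-invariant `φ : ℝ³ → ℂ`, not identically zero, with
`X φ + i a φ = 0` and `Y φ + i b φ = 0` everywhere, if and only if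
`a ∈ (2π/k)ℤ` and `b ∈ 2πℤ`.  Here `Γ_k`-invariance means
`φ(x+k,y,z) = φ(x,y+1,z+x) = φ(x,y,z+1) = φ(x,y,z)`. -/
theorem heisenberg_nilmanifold_zero_mode_iff (k : ℕ) (hk : 1 ≤ k) (a b : ℝ) :
    (∃ φ : ℝ × ℝ × ℝ → ℂ, ContDiff ℝ (⊤ : ℕ∞) φ ∧
      (∀ x y z : ℝ, φ (x + k, y, z) = φ (x, y, z) ∧
        φ (x, y + 1, z + x) = φ (x, y, z) ∧ φ (x, y, z + 1) = φ (x, y, z)) ∧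
      (∃ p, φ p ≠ 0) ∧
      (∀ p, heisX φ p + Complex.I * (a : ℂ) * φ p = 0) ∧
      (∀ p, heisY φ p + Complex.I * (b : ℂ) * φ p = 0))
    ↔ ((∃ m : ℤ, a = 2 * Real.pi / k * m) ∧ (∃ m : ℤ, b = 2 * Real.pi * m)) := by
  have hk0 : (k : ℝ) ≠ 0 := by positivity
  constructor
  · rintro ⟨φ, hsmooth, hinv, ⟨⟨x, y, z⟩, hp⟩, hX, hY⟩
    have hφ : Differentiable ℝ φ := hsmooth.differentiable (by simp)
    constructor
    · have h := apply_flow_heisX hφ hX x y z k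
      rw [apply_central_translation hφ hX hY, (hinv x y z).1, eq_comm, mul_eq_right₀ hp] at h
      obtain ⟨m, hm⟩ := exists_int_of_exp_neg_I_mul_eq_one (c := a * k)
        (by push_cast; rwa [← mul_assoc])
      refine ⟨m, ?_⟩
      field_simp
      linarith
    · have h := (hinv x y z).2.1
      rw [apply_central_translation hφ hX hY, apply_flow_heisY hφ hY, mul_eq_right₀ hp] at h
      exact exists_int_of_exp_neg_I_mul_eq_one (by simpa using h)
  · rintro ⟨⟨m, hm⟩, n, hn⟩
    refine ⟨heisZeroMode a b, contDiff_heisZeroMode a b, fun x y z => ⟨?_, ?_, ?_⟩,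
      ⟨0, Complex.exp_ne_zero _⟩, fun p => ?_, fun p => ?_⟩
    · refine heisZeroMode_add_period m ?_
      have : a * k = 2 * Real.pi * m := by
        rw [hm]
        field_simp
      linear_combination this
    · refine heisZeroMode_add_period n ?_
      linear_combination hn
    · rfl
    · simp [heisX, fderiv_heisZeroMode]
    · simp [heisY, fderiv_heisZeroMode]
end

section
/- Fix an integer k ≥ 1 and real numbers a, b. Let φ : ℝ³ → ℂ be smooth and Γ_k-invariant, i.e. φ(x+k,y,z) = φ(x,y+1,z+x) = φ(x,y,z+1) = φ(x,y,z) for all (x,y,z), where Γ_k = {(k n₁, n₂, n₃) : n₁,n₂,n₃ ∈ ℤ} acts on ℝ³ by the Heisenberg group law (x,y,z)·(x′,y′,z′) = (x+x′, y+y′, z+z′+x′y). Then, with F = (0,k)×(0,1)×(0,1) ⊂ ℝ³ and Lebesgue measure, ∫_F (|Xφ + i a φ|² + |Yφ + i b φ|²) ≥ min{ dist(a, (2π/k)ℤ)² + dist(b, 2πℤ)², 2π } · ∫_F |φ|², where X φ = ∂_x φ + y ∂_z φ, Y φ = ∂_y φ, and dist(t, cℤ) = inf_{n∈ℤ} |t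 − c n|. -/
open MeasureTheory

/-- `dist (t, cℤ) = inf_{n ∈ ℤ} |t - c n|`. -/
noncomputable def distZ (t c : ℝ) : ℝ := ⨅ n : ℤ, |t - c * n|

/-- The fundamental domain `F = (0,k) × (0,1) × (0,1)` of `Γ_k \ ℍ¹`. -/
def heisF (k : ℕ) : Set (ℝ × ℝ × ℝ) :=
  Set.Ioo (0 : ℝ) (k : ℝ) ×ˢ (Set.Ioo (0 : ℝ) 1 ×ˢ Set.Ioo (0 : ℝ) 1)

/-- Integration by parts against an exponential character, for a function with equal values at the
endpoints. -/
lemma integral_cexp_mul_deriv {L : ℝ} {c : ℂ} {f f' : ℝ → ℂ}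
    (hf : ∀ x, HasDerivAt f (f' x) x) (hf' : Continuous f')
    (hc : Complex.exp (-(c * L)) = 1) (hL : f L = f 0) :
    ∫ x in (0 : ℝ)..L, Complex.exp (-(c * x)) * f' x =
      c * ∫ x in (0 : ℝ)..L, Complex.exp (-(c * x)) * f x := by
  have hfc : Continuous f := continuous_iff_continuousAt.2 fun x => (hf x).continuousAt
  have hd : ∀ x : ℝ, HasDerivAt (fun x : ℝ => Complex.exp (-(c * x)) * f x)
      (Complex.exp (-(c * x)) * f' x - c * (Complex.exp (-(c * x)) * f x)) x := by
    intro x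
    have h1 : HasDerivAt (fun x : ℝ => -(c * (x : ℂ))) (-(c * 1)) x :=
      ((Complex.ofRealCLM.hasDerivAt (x := x)).const_mul c).neg
    refine (h1.cexp.mul (hf x)).congr_deriv ?_
    ring
  have h := intervalIntegral.integral_eq_sub_of_hasDerivAt (a := 0) (b := L)
    (fun x _ => hd x) (Continuous.intervalIntegrable (by fun_prop) _ _)
  rw [intervalIntegral.integral_sub (Continuous.intervalIntegrable (by fun_prop) _ _)
    (Continuous.intervalIntegrable (by fun_prop) _ _), intervalIntegral.integral_const_mul] at h
  rw [hc, hL] at h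
  simp only [Complex.ofReal_zero, mul_zero, neg_zero, Complex.exp_zero, sub_self] at h
  exact sub_eq_zero.1 h

lemma cexp_neg_two_pi_mul_int_div {L : ℝ} (hL : L ≠ 0) (n : ℤ) :
    Complex.exp (-(2 * Real.pi * Complex.I * n / L * L)) = 1 := by
  have : (L : ℂ) ≠ 0 := by exact_mod_cast hL
  rw [div_mul_cancel₀ _ this, Complex.exp_neg, inv_eq_one, mul_comm]
  exact Complex.exp_int_mul_two_pi_mul_I n

/-- Parseval's identity on `[0, L]` for continuous functions, with unnormalised coefficients. -/
lemma hasSum_sq_norm_integral_cexp_mul {L : ℝ} (hL : 0 < L) {f : ℝ → ℂ} (hf : Continuous f) :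
    HasSum (fun n : ℤ =>
        ‖∫ x in (0 : ℝ)..L, Complex.exp (-(2 * Real.pi * Complex.I * n / L * x)) * f x‖ ^ 2)
      (L * ∫ x in (0 : ℝ)..L, ‖f x‖ ^ 2) := by
  have hmem : MemLp f 2 (volume.restrict (Set.Ioc 0 L)) := by
    obtain ⟨C, hC⟩ := (isCompact_Icc (a := 0) (b := L)).exists_bound_of_continuousOn hf.continuousOn
    exact MemLp.of_bound hf.aestronglyMeasurable C
      (ae_restrict_of_forall_mem measurableSet_Ioc fun x hx => hC x (Set.Ioc_subset_Icc_self hx))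
  have h := (hasSum_sq_fourierCoeffOn hL hmem).mul_left (L ^ 2)
  have hcoef : ∀ n : ℤ, L ^ 2 * ‖fourierCoeffOn hL f n‖ ^ 2 =
      ‖∫ x in (0 : ℝ)..L, Complex.exp (-(2 * Real.pi * Complex.I * n / L * x)) * f x‖ ^ 2 := by
    intro n
    have h1 : L ^ 2 * ‖1 / (L - 0)‖ ^ 2 = 1 := by
      rw [sub_zero, ← mul_pow, Real.norm_of_nonneg (by positivity), mul_one_div_cancel hL.ne',
        one_pow]
    rw [fourierCoeffOn_eq_integral, norm_smul, mul_pow, ← mul_assoc, h1, one_mul]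
    congr 3
    ext x
    rw [fourier_coe_apply, smul_eq_mul]
    congr 2
    push_cast
    rw [sub_zero]
    ring
  have hnorm : L ^ 2 * (L - 0)⁻¹ • ∫ x in (0 : ℝ)..L, ‖f x‖ ^ 2 =
      L * ∫ x in (0 : ℝ)..L, ‖f x‖ ^ 2 := by
    rw [smul_eq_mul, sub_zero]
    field_simp
  simp_rw [hcoef] at h
  rwa [hnorm] at h

lemma distZ_nonneg (t c : ℝ) : 0 ≤ distZ t c := Real.iInf_nonneg fun _ => abs_nonneg _

lemma distZ_le (t c : ℝ) (n : ℤ) : distZ t c ≤ |c * n + t| := by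
  have h : distZ t c ≤ |t - c * ((-n : ℤ) : ℝ)| :=
    ciInf_le ⟨0, by rintro _ ⟨m, rfl⟩; exact abs_nonneg _⟩ (-n)
  refine h.trans_eq ?_
  push_cast
  congr 1
  ring

/-- Lower bound for the Rayleigh quotient of the magnetic derivative on a circle of length `L`. -/
lemma distZ_sq_mul_integral_le {L : ℝ} (hL : 0 < L) (a : ℝ) {f f' : ℝ → ℂ}
    (hf : ∀ x, HasDerivAt f (f' x) x) (hf' : Continuous f') (hper : f L = f 0) :
    distZ a (2 * Real.pi / L) ^ 2 * ∫ x in (0 : ℝ)..L, ‖f x‖ ^ 2 ≤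
      ∫ x in (0 : ℝ)..L, ‖f' x + Complex.I * a * f x‖ ^ 2 := by
  have hfc : Continuous f := continuous_iff_continuousAt.2 fun x => (hf x).continuousAt
  have h1 := (hasSum_sq_norm_integral_cexp_mul hL hfc).mul_left (distZ a (2 * Real.pi / L) ^ 2)
  have h2 := hasSum_sq_norm_integral_cexp_mul hL
    (f := fun x => f' x + Complex.I * a * f x) (by fun_prop)
  have h3 := hasSum_le (fun n => ?_) h1 h2
  · rw [mul_left_comm] at h3
    exact le_of_mul_le_mul_left h3 hL
  · have hI : ∫ x in (0 : ℝ)..L, Complex.exp (-(2 * Real.pi * Complex.I * n / L * x)) *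
          (f' x + Complex.I * a * f x) = (((2 * Real.pi / L * n + a : ℝ) : ℂ) * Complex.I) *
          ∫ x in (0 : ℝ)..L, Complex.exp (-(2 * Real.pi * Complex.I * n / L * x)) * f x := by
      simp_rw [mul_add]
      rw [intervalIntegral.integral_add (Continuous.intervalIntegrable (by fun_prop) _ _)
        (Continuous.intervalIntegrable (by fun_prop) _ _),
        integral_cexp_mul_deriv hf hf' (cexp_neg_two_pi_mul_int_div hL.ne' n) hper]
      simp_rw [mul_left_comm _ (Complex.I * a)]
      rw [intervalIntegral.integral_const_mul]
      push_cast
      ring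
    rw [hI, norm_mul, mul_pow]
    gcongr
    · exact distZ_nonneg _ _
    · rw [norm_mul, Complex.norm_I, mul_one, Complex.norm_real, Real.norm_eq_abs]
      exact distZ_le _ _ _

/-- Differentiation under the integral sign over a compact interval. -/
lemma hasDerivAt_intervalIntegral_of_continuous {H H' : ℝ → ℝ → ℂ}
    (hH : Continuous H.uncurry) (hH' : Continuous H'.uncurry)
    (hd : ∀ x z, HasDerivAt (fun x => H x z) (H' x z) x) (α β x₀ : ℝ) :
    HasDerivAt (fun x => ∫ z in α..β, H x z) (∫ z in α..β, H' x₀ z) x₀ := by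
  obtain ⟨C, hC⟩ := ((isCompact_closedBall x₀ 1).prod
    (isCompact_uIcc (a := α) (b := β))).exists_bound_of_continuousOn hH'.continuousOn
  have hcz : ∀ x, Continuous (H x) := fun x => hH.comp (Continuous.prodMk_right x)
  have hcz' : ∀ x, Continuous (H' x) := fun x => hH'.comp (Continuous.prodMk_right x)
  refine (intervalIntegral.hasDerivAt_integral_of_dominated_loc_of_deriv_le
    (bound := fun _ => C) (Metric.closedBall_mem_nhds x₀ one_pos)
    (Filter.Eventually.of_forall fun x => (hcz x).aestronglyMeasurable)
    ((hcz x₀).intervalIntegrable _ _) (hcz' x₀).aestronglyMeasurable ?_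
    intervalIntegrable_const ?_).2
  · exact Filter.Eventually.of_forall fun z hz x hx =>
      hC (x, z) ⟨hx, Set.uIoc_subset_uIcc hz⟩
  · exact Filter.Eventually.of_forall fun z _ x _ => hd x z

lemma integrableOn_Ioo_prod_Ioo {h : ℝ × ℝ → ℝ} (hh : Continuous h) (L M : ℝ) :
    IntegrableOn h (Set.Ioo 0 L ×ˢ Set.Ioo 0 M) :=
  (hh.continuousOn.integrableOn_compact (isCompact_Icc.prod isCompact_Icc)).mono_set
    (Set.prod_mono (Set.Ioo_subset_Icc_self (a := (0 : ℝ)) (b := L))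
      (Set.Ioo_subset_Icc_self (a := (0 : ℝ)) (b := M)))

lemma setIntegral_rect {L M : ℝ} (hL : 0 ≤ L) (hM : 0 ≤ M) {h : ℝ × ℝ → ℝ} (hh : Continuous h) :
    ∫ q in Set.Ioo 0 L ×ˢ Set.Ioo 0 M, h q =
      ∫ x in (0 : ℝ)..L, ∫ y in (0 : ℝ)..M, h (x, y) := by
  have h1 := integrableOn_Ioo_prod_Ioo hh L M
  rw [Measure.volume_eq_prod] at h1 ⊢
  rw [setIntegral_prod _ h1, intervalIntegral.integral_of_le hL, integral_Ioc_eq_integral_Ioo]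
  simp_rw [intervalIntegral.integral_of_le hM, integral_Ioc_eq_integral_Ioo]

lemma setIntegral_rect_swap {L M : ℝ} (hL : 0 ≤ L) (hM : 0 ≤ M) {h : ℝ × ℝ → ℝ}
    (hh : Continuous h) :
    ∫ q in Set.Ioo 0 L ×ˢ Set.Ioo 0 M, h q =
      ∫ y in (0 : ℝ)..M, ∫ x in (0 : ℝ)..L, h (x, y) := by
  have h1 := setIntegral_rect hM hL (h := fun q => h q.swap) (by fun_prop)
  rw [Measure.volume_eq_prod, setIntegral_prod_swap] at h1
  exact h1

/-- The integral over a rectangle of an `x`-derivative vanishes when the boundary values match. -/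
lemma setIntegral_rect_fst_deriv_eq_zero {L M : ℝ} (hL : 0 ≤ L) (hM : 0 ≤ M) {W W' : ℝ × ℝ → ℝ}
    (hW' : Continuous W') (hd : ∀ x y, HasDerivAt (fun x => W (x, y)) (W' (x, y)) x)
    (hper : ∀ y, W (L, y) = W (0, y)) :
    ∫ q in Set.Ioo 0 L ×ˢ Set.Ioo 0 M, W' q = 0 := by
  rw [setIntegral_rect_swap hL hM hW']
  have : ∀ y, ∫ x in (0 : ℝ)..L, W' (x, y) = 0 := fun y => by
    rw [intervalIntegral.integral_eq_sub_of_hasDerivAt (fun x _ => hd x y)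
      (Continuous.intervalIntegrable (by fun_prop) _ _), hper, sub_self]
  simp [this]

/-- The integral over a rectangle of a `y`-derivative vanishes when the boundary values match. -/
lemma setIntegral_rect_snd_deriv_eq_zero {L M : ℝ} (hL : 0 ≤ L) (hM : 0 ≤ M) {W W' : ℝ × ℝ → ℝ}
    (hW' : Continuous W') (hd : ∀ x y, HasDerivAt (fun y => W (x, y)) (W' (x, y)) y)
    (hper : ∀ x, W (x, M) = W (x, 0)) :
    ∫ q in Set.Ioo 0 L ×ˢ Set.Ioo 0 M, W' q = 0 := by
  rw [setIntegral_rect hL hM hW']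
  have : ∀ x, ∫ y in (0 : ℝ)..M, W' (x, y) = 0 := fun x => by
    rw [intervalIntegral.integral_eq_sub_of_hasDerivAt (fun y _ => hd x y)
      (Continuous.intervalIntegrable (by fun_prop) _ _), hper, sub_self]
  simp [this]

lemma HasDerivAt.im_conj_mul {f g : ℝ → ℂ} {f' g' : ℂ} {x : ℝ} (hf : HasDerivAt f f' x)
    (hg : HasDerivAt g g' x) :
    HasDerivAt (fun x => (star (f x) * g x).im) (star f' * g x + star (f x) * g').im x :=
  Complex.imCLM.hasFDerivAt.comp_hasDerivAt x (hf.star.mul hg)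

/-- The lowest Landau level bound for a magnetic Laplacian with constant field `B` on a rectangle,
for a section `f` with magnetic derivatives `P` and `Q` whose boundary currents match. -/
lemma abs_mul_setIntegral_le {L M a b B : ℝ} (hL : 0 ≤ L) (hM : 0 ≤ M)
    {f P Q P' Q' : ℝ × ℝ → ℂ} (hf : Continuous f) (hP : Continuous P) (hQ : Continuous Q)
    (hP' : Continuous P') (hQ' : Continuous Q')
    (hfx : ∀ x y, HasDerivAt (fun x => f (x, y))
      (P (x, y) - Complex.I * (B * y + a) * f (x, y)) x)
    (hfy : ∀ x y, HasDerivAt (fun y => f (x, y)) (Q (x, y) - Complex.I * b * f (x, y)) y)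
    (hPy : ∀ x y, HasDerivAt (fun y => P (x, y)) (P' (x, y) - Complex.I * b * P (x, y)) y)
    (hQx : ∀ x y, HasDerivAt (fun x => Q (x, y))
      (Q' (x, y) - Complex.I * (B * y + a) * Q (x, y)) x)
    (hcomm : ∀ q, Q' q - P' q = -(Complex.I * B * f q))
    (hperx : ∀ y, (star (f (L, y)) * Q (L, y)).im = (star (f (0, y)) * Q (0, y)).im)
    (hpery : ∀ x, (star (f (x, M)) * P (x, M)).im = (star (f (x, 0)) * P (x, 0)).im) :
    |B| * ∫ q in Set.Ioo 0 L ×ˢ Set.Ioo 0 M, ‖f q‖ ^ 2 ≤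
      ∫ q in Set.Ioo 0 L ×ˢ Set.Ioo 0 M, (‖P q‖ ^ 2 + ‖Q q‖ ^ 2) := by
  have h1 := setIntegral_rect_fst_deriv_eq_zero hL hM (W := fun q => (star (f q) * Q q).im)
    (W' := fun q => (star (P q - Complex.I * (B * q.2 + a) * f q) * Q q +
      star (f q) * (Q' q - Complex.I * (B * q.2 + a) * Q q)).im)
    (by fun_prop) (fun x y => (hfx x y).im_conj_mul (hQx x y)) hperx
  have h2 := setIntegral_rect_snd_deriv_eq_zero hL hM (W := fun q => (star (f q) * P q).im)
    (W' := fun q => (star (Q q - Complex.I * b * f q) * P q +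
      star (f q) * (P' q - Complex.I * b * P q)).im)
    (by fun_prop) (fun x y => (hfy x y).im_conj_mul (hPy x y)) hpery
  have h3 : ∫ q in Set.Ioo 0 L ×ˢ Set.Ioo 0 M, (2 * (star (P q) * Q q).im - B * ‖f q‖ ^ 2) = 0 := by
    refine Eq.trans ?_ ((congrArg₂ (· - ·) h1 h2).trans (sub_self 0))
    rw [← integral_sub (integrableOn_Ioo_prod_Ioo (by fun_prop) L M)
      (integrableOn_Ioo_prod_Ioo (by fun_prop) L M)]
    refine integral_congr_ae (Filter.Eventually.of_forall fun q => ?_)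
    have hq : Q' q = P' q - Complex.I * B * f q := by linear_combination hcomm q
    simp only [hq, ← Complex.normSq_eq_norm_sq, Complex.normSq_apply]
    simp
    ring
  rw [integral_sub (integrableOn_Ioo_prod_Ioo (by fun_prop) L M)
    (integrableOn_Ioo_prod_Ioo (by fun_prop) L M), integral_const_mul B, sub_eq_zero] at h3
  have h4 : 0 ≤ ∫ q in Set.Ioo 0 L ×ˢ Set.Ioo 0 M, ‖f q‖ ^ 2 :=
    integral_nonneg fun q => by positivity
  rw [← abs_of_nonneg h4, ← abs_mul, ← h3]
  refine (abs_integral_le_integral_abs).trans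
    (integral_mono (integrableOn_Ioo_prod_Ioo (by fun_prop) L M)
      (integrableOn_Ioo_prod_Ioo (by fun_prop) L M) fun q => ?_)
  have h5 : |(star (P q) * Q q).im| ≤ ‖P q‖ * ‖Q q‖ := by
    simpa using Complex.abs_im_le_norm (star (P q) * Q q)
  simp only [abs_mul, abs_two]
  nlinarith [sq_nonneg (‖P q‖ - ‖Q q‖)]

/-- The `m`-th Fourier coefficient in the central variable `z`. -/
noncomputable def zCoeff (m : ℤ) (G : ℝ × ℝ × ℝ → ℂ) (q : ℝ × ℝ) : ℂ :=
  ∫ z in (0 : ℝ)..1, Complex.exp (-(2 * Real.pi * Complex.I * m * z)) * G (q.1, q.2, z)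

/-- The magnetic horizontal derivative `X + ia`. -/
noncomputable def magX (a : ℝ) (G : ℝ × ℝ × ℝ → ℂ) (p : ℝ × ℝ × ℝ) : ℂ :=
  heisX G p + Complex.I * a * G p

/-- The magnetic horizontal derivative `Y + ib`. -/
noncomputable def magY (b : ℝ) (G : ℝ × ℝ × ℝ → ℂ) (p : ℝ × ℝ × ℝ) : ℂ :=
  heisY G p + Complex.I * b * G p

section Smoothness

variable {G : ℝ × ℝ × ℝ → ℂ}

lemma contDiff_fderiv_apply_const (hG : ContDiff ℝ (⊤ : ℕ∞) G) (w : ℝ × ℝ × ℝ) :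
    ContDiff ℝ (⊤ : ℕ∞) fun p => fderiv ℝ G p w :=
  (hG.fderiv_right (m := (⊤ : ℕ∞)) (by simp)).clm_apply contDiff_const

lemma contDiff_heisX (hG : ContDiff ℝ (⊤ : ℕ∞) G) : ContDiff ℝ (⊤ : ℕ∞) (heisX G) :=
  (contDiff_fderiv_apply_const hG _).add
    ((contDiff_fst.comp contDiff_snd).smul (contDiff_fderiv_apply_const hG _))

lemma contDiff_heisY (hG : ContDiff ℝ (⊤ : ℕ∞) G) : ContDiff ℝ (⊤ : ℕ∞) (heisY G) :=
  contDiff_fderiv_apply_const hG _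

lemma contDiff_magX (a : ℝ) (hG : ContDiff ℝ (⊤ : ℕ∞) G) : ContDiff ℝ (⊤ : ℕ∞) (magX a G) :=
  (contDiff_heisX hG).add (contDiff_const.mul hG)

lemma contDiff_magY (b : ℝ) (hG : ContDiff ℝ (⊤ : ℕ∞) G) : ContDiff ℝ (⊤ : ℕ∞) (magY b G) :=
  (contDiff_heisY hG).add (contDiff_const.mul hG)

lemma heisX_add_const_mul (hG : ContDiff ℝ (⊤ : ℕ∞) G) {H : ℝ × ℝ × ℝ → ℂ}
    (hH : ContDiff ℝ (⊤ : ℕ∞) H) (c : ℂ) (p : ℝ × ℝ × ℝ) :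
    heisX (fun p => H p + c * G p) p = heisX H p + c * heisX G p := by
  have hG' := (hG.differentiable (by simp)) p
  have hH' := (hH.differentiable (by simp)) p
  have h : fderiv ℝ (fun p => H p + c * G p) p = fderiv ℝ H p + c • fderiv ℝ G p :=
    (hH'.hasFDerivAt.add (hG'.hasFDerivAt.const_mul c)).fderiv
  simp only [heisX, h, add_apply, smul_apply, smul_eq_mul,
    Complex.real_smul]
  ring

lemma heisY_add_const_mul (hG : ContDiff ℝ (⊤ : ℕ∞) G) {H : ℝ × ℝ × ℝ → ℂ}
    (hH : ContDiff ℝ (⊤ : ℕ∞) H) (c : ℂ) (p : ℝ × ℝ × ℝ) :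
    heisY (fun p => H p + c * G p) p = heisY H p + c * heisY G p := by
  have hG' := (hG.differentiable (by simp)) p
  have hH' := (hH.differentiable (by simp)) p
  have h : fderiv ℝ (fun p => H p + c * G p) p = fderiv ℝ H p + c • fderiv ℝ G p :=
    (hH'.hasFDerivAt.add (hG'.hasFDerivAt.const_mul c)).fderiv
  simp only [heisY, h, add_apply, smul_apply, smul_eq_mul]

/-- The Heisenberg commutation relation `[X, Y] = -∂_z`. -/
lemma heisX_heisY_sub_heisY_heisX (hG : ContDiff ℝ (⊤ : ℕ∞) G) (p : ℝ × ℝ × ℝ) :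
    heisX (heisY G) p - heisY (heisX G) p = -fderiv ℝ G p (0, 0, 1) := by
  have hsymm : IsSymmSndFDerivAt ℝ G p :=
    hG.contDiffAt.isSymmSndFDerivAt (by simpa using WithTop.coe_le_coe.2 (le_top (a := (2 : ℕ∞))))
  have hd : DifferentiableAt ℝ (fderiv ℝ G) p :=
    (hG.fderiv_right (m := (⊤ : ℕ∞)) (by simp)).differentiable (by simp) p
  have hw : ∀ w, HasFDerivAt (fun p => fderiv ℝ G p w)
      ((ContinuousLinearMap.apply ℝ ℂ w).comp (fderiv ℝ (fderiv ℝ G) p)) p := fun w =>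
    (ContinuousLinearMap.apply ℝ ℂ w).hasFDerivAt.comp p hd.hasFDerivAt
  have hy : HasFDerivAt (fun p : ℝ × ℝ × ℝ => p.2.1)
      ((ContinuousLinearMap.fst ℝ ℝ ℝ).comp (ContinuousLinearMap.snd ℝ ℝ (ℝ × ℝ))) p :=
    ((ContinuousLinearMap.fst ℝ ℝ ℝ).comp (ContinuousLinearMap.snd ℝ ℝ (ℝ × ℝ))).hasFDerivAt
  have hY : fderiv ℝ (heisY G) p = _ := (hw (0, 1, 0)).fderiv
  have hX : fderiv ℝ (heisX G) p = _ := ((hw (1, 0, 0)).add (hy.smul (hw (0, 0, 1)))).fderiv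
  rw [heisX, heisY, hY, hX]
  simp [hsymm.eq (1, 0, 0) (0, 1, 0), hsymm.eq (0, 0, 1) (0, 1, 0)]

lemma magX_magY_sub_magY_magX (hG : ContDiff ℝ (⊤ : ℕ∞) G) (a b : ℝ) (p : ℝ × ℝ × ℝ) :
    magX a (magY b G) p - magY b (magX a G) p = -fderiv ℝ G p (0, 0, 1) := by
  have hX : heisX (magY b G) p = _ := heisX_add_const_mul hG (contDiff_heisY hG) _ p
  have hY : heisY (magX a G) p = _ := heisY_add_const_mul hG (contDiff_heisX hG) _ p
  rw [magX, magY, magY, hX, hY, magX, ← heisX_heisY_sub_heisY_heisX hG p]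
  ring

end Smoothness

section Invariance

variable {G : ℝ × ℝ × ℝ → ℂ}

lemma fderiv_eq_of_forall_add_eq {w : ℝ × ℝ × ℝ} (h : ∀ p, G (p + w) = G p) (p : ℝ × ℝ × ℝ) :
    fderiv ℝ G (p + w) = fderiv ℝ G p := by
  rw [← fderiv_comp_add_right]
  simp_rw [h]

lemma magX_add_eq {w : ℝ × ℝ × ℝ} (hw : w.2.1 = 0) (h : ∀ p, G (p + w) = G p) (a : ℝ)
    (p : ℝ × ℝ × ℝ) : magX a G (p + w) = magX a G p := by
  simp [magX, heisX, fderiv_eq_of_forall_add_eq h, h, hw]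

lemma magY_add_eq {w : ℝ × ℝ × ℝ} (h : ∀ p, G (p + w) = G p) (b : ℝ)
    (p : ℝ × ℝ × ℝ) : magY b G (p + w) = magY b G p := by
  simp [magY, heisY, fderiv_eq_of_forall_add_eq h, h]

/-- `X + ia` commutes with the left translation by `(0, 1, 0)`. -/
lemma magX_twist_eq (hG : ContDiff ℝ (⊤ : ℕ∞) G)
    (h : ∀ x y z, G (x, y + 1, z + x) = G (x, y, z)) (a x y z : ℝ) :
    magX a G (x, y + 1, z + x) = magX a G (x, y, z) := by
  let A : ℝ × ℝ × ℝ →L[ℝ] ℝ × ℝ × ℝ := (ContinuousLinearMap.fst ℝ ℝ (ℝ × ℝ)).prod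
    (((ContinuousLinearMap.fst ℝ ℝ ℝ).comp (ContinuousLinearMap.snd ℝ ℝ (ℝ × ℝ))).prod
      (((ContinuousLinearMap.snd ℝ ℝ ℝ).comp (ContinuousLinearMap.snd ℝ ℝ (ℝ × ℝ))) +
        ContinuousLinearMap.fst ℝ ℝ (ℝ × ℝ)))
  have hA : HasFDerivAt (fun p => A p + (0, 1, 0)) A (x, y, z) := A.hasFDerivAt.add_const _
  have hT : A (x, y, z) + (0, 1, 0) = (x, y + 1, z + x) := by simp [A]
  have hcomp : (fun p => G (A p + (0, 1, 0))) = G := by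
    ext ⟨x, y, z⟩
    simpa [A] using h x y z
  have hd := ((hG.differentiable (by simp)) (A (x, y, z) + (0, 1, 0))).hasFDerivAt.comp (x, y, z) hA
  have hfd : fderiv ℝ G (x, y, z) = (fderiv ℝ G (x, y + 1, z + x)).comp A := by
    rw [← hT, ← hd.fderiv]
    exact congrArg (fun g => fderiv ℝ g (x, y, z)) hcomp.symm
  have hx : A (1, 0, 0) = (1, 0, 0) + (0, 0, 1) := by simp [A]
  have hz : A (0, 0, 1) = (0, 0, 1) := by simp [A]
  simp only [magX, heisX, hfd, ContinuousLinearMap.comp_apply, hx, hz, map_add, h,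
    Complex.real_smul]
  push_cast
  ring

end Invariance

section Coefficients

variable {G : ℝ × ℝ × ℝ → ℂ}

lemma continuous_zCoeff (m : ℤ) (hG : Continuous G) : Continuous (zCoeff m G) :=
  intervalIntegral.continuous_parametric_intervalIntegral_of_continuous'
    (f := fun (q : ℝ × ℝ) z =>
      Complex.exp (-(2 * Real.pi * Complex.I * m * z)) * G (q.1, q.2, z)) (by fun_prop) 0 1

lemma zCoeff_add_const_mul (m : ℤ) (hG : Continuous G) {H : ℝ × ℝ × ℝ → ℂ} (hH : Continuous H)
    (c : ℂ) (q : ℝ × ℝ) :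
    zCoeff m (fun p => H p + c * G p) q = zCoeff m H q + c * zCoeff m G q := by
  simp only [zCoeff]
  rw [← intervalIntegral.integral_const_mul, ← intervalIntegral.integral_add
    (Continuous.intervalIntegrable (by fun_prop) _ _)
    (Continuous.intervalIntegrable (by fun_prop) _ _)]
  congr 1
  ext z
  ring

lemma zCoeff_fderiv_z (m : ℤ) (hG : ContDiff ℝ (⊤ : ℕ∞) G)
    (hz : ∀ p, G (p + (0, 0, 1)) = G p) (q : ℝ × ℝ) :
    zCoeff m (fun p => fderiv ℝ G p (0, 0, 1)) q =
      2 * Real.pi * Complex.I * m * zCoeff m G q := by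
  have hc := (contDiff_fderiv_apply_const hG (0, 0, 1)).continuous
  refine integral_cexp_mul_deriv (f := fun z => G (q.1, q.2, z)) (fun z => ?_) (by fun_prop) ?_ ?_
  · have h1 : HasDerivAt (fun z : ℝ => (q.1, q.2, z)) (0, 0, 1) z :=
      (hasDerivAt_const z q.1).prodMk ((hasDerivAt_const z q.2).prodMk (hasDerivAt_id z))
    exact ((hG.differentiable (by simp)) _).hasFDerivAt.comp_hasDerivAt z h1
  · simpa using cexp_neg_two_pi_mul_int_div one_ne_zero m
  · simpa using hz (q.1, q.2, 0)

lemma zCoeff_heisX (m : ℤ) (hG : ContDiff ℝ (⊤ : ℕ∞) G)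
    (hz : ∀ p, G (p + (0, 0, 1)) = G p) (q : ℝ × ℝ) :
    zCoeff m (heisX G) q = zCoeff m (fun p => fderiv ℝ G p (1, 0, 0)) q +
      Complex.I * (2 * Real.pi * m * q.2) * zCoeff m G q := by
  have h := zCoeff_add_const_mul m (contDiff_fderiv_apply_const hG (0, 0, 1)).continuous
    (contDiff_fderiv_apply_const hG (1, 0, 0)).continuous q.2 q
  rw [zCoeff_fderiv_z m hG hz] at h
  refine Eq.trans ?_ (h.trans (by ring))
  simp [zCoeff, heisX]

lemma hasDerivAt_zCoeff_fst (m : ℤ) (hG : ContDiff ℝ (⊤ : ℕ∞) G)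
    (hz : ∀ p, G (p + (0, 0, 1)) = G p) (a x y : ℝ) :
    HasDerivAt (fun x => zCoeff m G (x, y)) (zCoeff m (magX a G) (x, y) -
      Complex.I * ((2 * Real.pi * m : ℝ) * y + a) * zCoeff m G (x, y)) x := by
  have hGc := hG.continuous
  have hc := (contDiff_fderiv_apply_const hG (1, 0, 0)).continuous
  have h1 : zCoeff m (magX a G) (x, y) = _ :=
    zCoeff_add_const_mul m hGc (contDiff_heisX hG).continuous (Complex.I * a) (x, y)
  rw [h1, zCoeff_heisX m hG hz]
  have h2 := hasDerivAt_intervalIntegral_of_continuous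
    (H := fun x z => Complex.exp (-(2 * Real.pi * Complex.I * m * z)) * G (x, y, z))
    (H' := fun x z => Complex.exp (-(2 * Real.pi * Complex.I * m * z)) *
      fderiv ℝ G (x, y, z) (1, 0, 0)) (by fun_prop) (by fun_prop) (fun x z => ?_) 0 1 x
  · refine h2.congr_deriv ?_
    simp only [zCoeff]
    push_cast
    ring
  · have h1 : HasDerivAt (fun x : ℝ => (x, y, z)) (1, 0, 0) x :=
      (hasDerivAt_id x).prodMk ((hasDerivAt_const x y).prodMk (hasDerivAt_const x z))
    exact (((hG.differentiable (by simp)) _).hasFDerivAt.comp_hasDerivAt x h1).const_mul _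

lemma hasDerivAt_zCoeff_snd (m : ℤ) (hG : ContDiff ℝ (⊤ : ℕ∞) G) (b x y : ℝ) :
    HasDerivAt (fun y => zCoeff m G (x, y)) (zCoeff m (magY b G) (x, y) -
      Complex.I * b * zCoeff m G (x, y)) y := by
  have hGc := hG.continuous
  have hc := (contDiff_fderiv_apply_const hG (0, 1, 0)).continuous
  have h1 : zCoeff m (magY b G) (x, y) = _ :=
    zCoeff_add_const_mul m hGc (contDiff_heisY hG).continuous (Complex.I * b) (x, y)
  rw [h1]
  have h2 := hasDerivAt_intervalIntegral_of_continuous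
    (H := fun y z => Complex.exp (-(2 * Real.pi * Complex.I * m * z)) * G (x, y, z))
    (H' := fun y z => Complex.exp (-(2 * Real.pi * Complex.I * m * z)) *
      fderiv ℝ G (x, y, z) (0, 1, 0)) (by fun_prop) (by fun_prop) (fun y z => ?_) 0 1 y
  · refine h2.congr_deriv ?_
    rw [add_sub_cancel_right]
    rfl
  · have h1 : HasDerivAt (fun y : ℝ => (x, y, z)) (0, 1, 0) y :=
      (hasDerivAt_const y x).prodMk ((hasDerivAt_id y).prodMk (hasDerivAt_const y z))
    exact (((hG.differentiable (by simp)) _).hasFDerivAt.comp_hasDerivAt y h1).const_mul _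

/-- The quasi-periodicity in `y` of the Fourier coefficients of a `Γ_k`-invariant function. -/
lemma zCoeff_one (m : ℤ) (hz : ∀ p, G (p + (0, 0, 1)) = G p)
    (htw : ∀ x y z, G (x, y + 1, z + x) = G (x, y, z)) (x : ℝ) :
    zCoeff m G (x, 1) = Complex.exp (-(2 * Real.pi * Complex.I * m * x)) * zCoeff m G (x, 0) := by
  let g : ℝ → ℂ := fun z => Complex.exp (-(2 * Real.pi * Complex.I * m * z)) * G (x, 1, z)
  have hg : Function.Periodic g 1 := fun z => by
    have h1 : G (x, 1, z + 1) = G (x, 1, z) := by simpa using hz (x, 1, z)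
    have h2 := cexp_neg_two_pi_mul_int_div one_ne_zero m
    simp only [Complex.ofReal_one, div_one, mul_one] at h2
    simp only [g, h1]
    push_cast
    rw [mul_add, neg_add, Complex.exp_add, mul_one, h2, mul_one]
  have h1 : zCoeff m G (x, 1) = ∫ z in (0 : ℝ)..1, g z := rfl
  have h2 : ∫ z in (0 : ℝ)..1, g z = ∫ z in x..x + 1, g z := by
    simpa using hg.intervalIntegral_add_eq 0 x
  have h3 : ∫ z in (0 : ℝ)..1, g (z + x) = ∫ z in x..x + 1, g z := by
    rw [intervalIntegral.integral_comp_add_right, zero_add, add_comm]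
  rw [h1, h2, ← h3, zCoeff, ← intervalIntegral.integral_const_mul]
  congr 1
  ext z
  have h4 : G (x, 1, z + x) = G (x, 0, z) := by simpa using htw x 0 z
  simp only [g, h4]
  push_cast
  rw [mul_add, neg_add, Complex.exp_add]
  ring

lemma integrableOn_heisF {h : ℝ × ℝ × ℝ → ℝ} (hh : Continuous h) (k : ℕ) :
    IntegrableOn h (heisF k) :=
  (hh.continuousOn.integrableOn_compact
    (isCompact_Icc.prod (isCompact_Icc.prod isCompact_Icc))).mono_set
    (Set.prod_mono (Set.Ioo_subset_Icc_self (a := (0 : ℝ)) (b := (k : ℝ)))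
      (Set.prod_mono (Set.Ioo_subset_Icc_self (a := (0 : ℝ)) (b := 1))
        (Set.Ioo_subset_Icc_self (a := (0 : ℝ)) (b := 1))))

lemma setIntegral_heisF {h : ℝ × ℝ × ℝ → ℝ} (hh : Continuous h) (k : ℕ) :
    ∫ p in heisF k, h p = ∫ q in Set.Ioo (0 : ℝ) k ×ˢ Set.Ioo (0 : ℝ) 1,
      ∫ z in (0 : ℝ)..1, h (q.1, q.2, z) := by
  have hcont : Continuous fun q : ℝ × ℝ => ∫ z in (0 : ℝ)..1, h (q.1, q.2, z) :=
    intervalIntegral.continuous_parametric_intervalIntegral_of_continuous' (by fun_prop) _ _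
  have h1 := integrableOn_heisF hh k
  rw [setIntegral_rect k.cast_nonneg zero_le_one hcont,
    intervalIntegral.integral_of_le k.cast_nonneg, integral_Ioc_eq_integral_Ioo]
  rw [heisF, Measure.volume_eq_prod] at h1 ⊢
  rw [setIntegral_prod _ h1]
  refine setIntegral_congr_fun measurableSet_Ioo fun x _ => ?_
  exact setIntegral_rect zero_le_one zero_le_one (h := fun r => h (x, r)) (by fun_prop)

/-- Parseval's identity in the central variable, integrated over the base. -/
lemma hasSum_setIntegral_sq_norm_zCoeff (k : ℕ) (hG : Continuous G) :
    HasSum (fun m : ℤ => ∫ q in Set.Ioo (0 : ℝ) k ×ˢ Set.Ioo (0 : ℝ) 1, ‖zCoeff m G q‖ ^ 2)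
      (∫ p in heisF k, ‖G p‖ ^ 2) := by
  have hpt : ∀ q : ℝ × ℝ, HasSum (fun m : ℤ => ‖zCoeff m G q‖ ^ 2)
      (∫ z in (0 : ℝ)..1, ‖G (q.1, q.2, z)‖ ^ 2) := fun q => by
    simpa [zCoeff] using hasSum_sq_norm_integral_cexp_mul one_pos
      (f := fun z => G (q.1, q.2, z)) (by fun_prop)
  have hcont : Continuous fun q : ℝ × ℝ => ∫ z in (0 : ℝ)..1, ‖G (q.1, q.2, z)‖ ^ 2 :=
    intervalIntegral.continuous_parametric_intervalIntegral_of_continuous' (by fun_prop) _ _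
  rw [setIntegral_heisF (h := fun p => ‖G p‖ ^ 2) (by fun_prop)]
  refine hasSum_integral_of_dominated_convergence (fun m q => ‖zCoeff m G q‖ ^ 2)
    (fun m => ((continuous_zCoeff m hG).norm.pow 2).aestronglyMeasurable)
    (fun m => Filter.Eventually.of_forall fun q => by simp)
    (Filter.Eventually.of_forall fun q => (hpt q).summable) ?_
    (Filter.Eventually.of_forall hpt)
  simp_rw [fun q => (hpt q).tsum_eq]
  exact integrableOn_Ioo_prod_Ioo hcont _ _

end Coefficients

section Modes

variable {k : ℕ} {φ : ℝ × ℝ × ℝ → ℂ}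

lemma zCoeff_eq_of_forall_add_eq {G : ℝ × ℝ × ℝ → ℂ} {L : ℝ}
    (h : ∀ p, G (p + (L, 0, 0)) = G p) (m : ℤ) (y : ℝ) :
    zCoeff m G (L, y) = zCoeff m G (0, y) := by
  have : ∀ z, G (L, y, z) = G (0, y, z) := fun z => by simpa using h (0, y, z)
  simp [zCoeff, this]

/-- The Rayleigh quotient bound for the zero mode in `z`. -/
lemma zCoeff_zero_rayleigh (hk : 1 ≤ k) (a b : ℝ) (hφ : ContDiff ℝ (⊤ : ℕ∞) φ)
    (hx : ∀ p, φ (p + ((k : ℝ), 0, 0)) = φ p) (hz : ∀ p, φ (p + (0, 0, 1)) = φ p)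
    (htw : ∀ x y z, φ (x, y + 1, z + x) = φ (x, y, z)) :
    (distZ a (2 * Real.pi / k) ^ 2 + distZ b (2 * Real.pi) ^ 2) *
        ∫ q in Set.Ioo (0 : ℝ) k ×ˢ Set.Ioo (0 : ℝ) 1, ‖zCoeff 0 φ q‖ ^ 2 ≤
      ∫ q in Set.Ioo (0 : ℝ) k ×ˢ Set.Ioo (0 : ℝ) 1,
        (‖zCoeff 0 (magX a φ) q‖ ^ 2 + ‖zCoeff 0 (magY b φ) q‖ ^ 2) := by
  have hk0 : (0 : ℝ) < k := by exact_mod_cast hk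
  have hf := continuous_zCoeff 0 hφ.continuous
  have hP := continuous_zCoeff 0 (contDiff_magX a hφ).continuous
  have hQ := continuous_zCoeff 0 (contDiff_magY b hφ).continuous
  rw [integral_add (integrableOn_Ioo_prod_Ioo (by fun_prop) _ _)
    (integrableOn_Ioo_prod_Ioo (by fun_prop) _ _), add_mul]
  refine add_le_add ?_ ?_
  · rw [setIntegral_rect_swap hk0.le zero_le_one (by fun_prop),
      setIntegral_rect_swap hk0.le zero_le_one (by fun_prop),
      ← intervalIntegral.integral_const_mul]
    refine intervalIntegral.integral_mono_on zero_le_one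
      (Continuous.intervalIntegrable (continuous_const.mul
        (intervalIntegral.continuous_parametric_intervalIntegral_of_continuous'
          (by fun_prop) _ _)) _ _)
      (Continuous.intervalIntegrable
        (intervalIntegral.continuous_parametric_intervalIntegral_of_continuous'
          (by fun_prop) _ _) _ _) fun y _ => ?_
    refine (distZ_sq_mul_integral_le hk0 a (f := fun x => zCoeff 0 φ (x, y))
      (fun x => hasDerivAt_zCoeff_fst 0 hφ hz a x y) (by fun_prop)
      (zCoeff_eq_of_forall_add_eq hx 0 y)).trans_eq ?_
    simp
  · rw [setIntegral_rect hk0.le zero_le_one (by fun_prop),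
      setIntegral_rect hk0.le zero_le_one (by fun_prop),
      ← intervalIntegral.integral_const_mul]
    refine intervalIntegral.integral_mono_on hk0.le
      (Continuous.intervalIntegrable (continuous_const.mul
        (intervalIntegral.continuous_parametric_intervalIntegral_of_continuous'
          (by fun_prop) _ _)) _ _)
      (Continuous.intervalIntegrable
        (intervalIntegral.continuous_parametric_intervalIntegral_of_continuous'
          (by fun_prop) _ _) _ _) fun x _ => ?_
    have h := distZ_sq_mul_integral_le one_pos b (f := fun y => zCoeff 0 φ (x, y))
      (fun y => hasDerivAt_zCoeff_snd 0 hφ b x y) (by fun_prop)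
      (by simpa using zCoeff_one 0 hz htw x)
    simpa using h

/-- The Landau level bound for the modes that are not constant in `z`. -/
lemma zCoeff_rayleigh_of_ne_zero {m : ℤ} (hm : m ≠ 0) (a b : ℝ) (hφ : ContDiff ℝ (⊤ : ℕ∞) φ)
    (hx : ∀ p, φ (p + ((k : ℝ), 0, 0)) = φ p) (hz : ∀ p, φ (p + (0, 0, 1)) = φ p)
    (htw : ∀ x y z, φ (x, y + 1, z + x) = φ (x, y, z)) :
    2 * Real.pi * ∫ q in Set.Ioo (0 : ℝ) k ×ˢ Set.Ioo (0 : ℝ) 1, ‖zCoeff m φ q‖ ^ 2 ≤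
      ∫ q in Set.Ioo (0 : ℝ) k ×ˢ Set.Ioo (0 : ℝ) 1,
        (‖zCoeff m (magX a φ) q‖ ^ 2 + ‖zCoeff m (magY b φ) q‖ ^ 2) := by
  have hu := contDiff_magX a hφ
  have hv := contDiff_magY b hφ
  have huz := magX_add_eq (w := (0, 0, 1)) rfl hz a
  have h := abs_mul_setIntegral_le (L := k) (M := 1) (a := a) (b := b) (B := 2 * Real.pi * m)
    k.cast_nonneg zero_le_one
    (continuous_zCoeff m hφ.continuous) (continuous_zCoeff m hu.continuous)
    (continuous_zCoeff m hv.continuous)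
    (continuous_zCoeff m (contDiff_magY b hu).continuous)
    (continuous_zCoeff m (contDiff_magX a hv).continuous)
    (fun x y => hasDerivAt_zCoeff_fst m hφ hz a x y)
    (fun x y => hasDerivAt_zCoeff_snd m hφ b x y)
    (fun x y => hasDerivAt_zCoeff_snd m hu b x y)
    (fun x y => hasDerivAt_zCoeff_fst m hv (magY_add_eq hz b) a x y)
    (fun q => ?_) (fun y => ?_) (fun x => ?_)
  · refine le_trans ?_ h
    gcongr
    have h1 : (1 : ℝ) ≤ |(m : ℝ)| := by exact_mod_cast Int.one_le_abs hm
    rw [abs_mul, abs_of_pos Real.two_pi_pos]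
    nlinarith [Real.two_pi_pos]
  · have h1 := zCoeff_add_const_mul m (contDiff_magY b hu).continuous
      (contDiff_magX a hv).continuous (-1) q
    have h2 := zCoeff_fderiv_z m hφ hz q
    have h3 : zCoeff m (fun p => magX a (magY b φ) p + -1 * magY b (magX a φ) p) q =
        -zCoeff m (fun p => fderiv ℝ φ p (0, 0, 1)) q := by
      have h4 : ∀ p, magX a (magY b φ) p + -1 * magY b (magX a φ) p =
          -fderiv ℝ φ p (0, 0, 1) := fun p => by
        rw [← magX_magY_sub_magY_magX hφ a b p]
        ring
      rw [funext h4]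
      simp [zCoeff]
    rw [h3, h2] at h1
    push_cast
    linear_combination -h1
  · rw [zCoeff_eq_of_forall_add_eq hx, zCoeff_eq_of_forall_add_eq (magY_add_eq hx b)]
  · rw [zCoeff_one m hz htw, zCoeff_one m huz (magX_twist_eq hφ htw a)]
    have h1 : ∀ t : ℝ, star (Complex.exp (-(2 * Real.pi * Complex.I * m * t))) *
        Complex.exp (-(2 * Real.pi * Complex.I * m * t)) = 1 := fun t => by
      rw [Complex.star_def, ← Complex.exp_conj, ← Complex.exp_add]
      simp [Complex.conj_ofNat]
    congr 1
    rw [star_mul]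
    linear_combination star (zCoeff m φ (x, 0)) * zCoeff m (magX a φ) (x, 0) * h1 x

end Modes

/-- **Lower bound for the magnetic Rayleigh quotient on `Γ_k \ ℍ¹`.**
For every smooth `Γ_k`-invariant `φ : ℝ³ → ℂ`,
`∫_F (|Xφ + iaφ|² + |Yφ + ibφ|²) ≥ min{dist(a,(2π/k)ℤ)² + dist(b,2πℤ)², 2π} ∫_F |φ|²`. -/
theorem heisenberg_nilmanifold_rayleigh_lower_bound
    (k : ℕ) (hk : 1 ≤ k) (a b : ℝ) (φ : ℝ × ℝ × ℝ → ℂ)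
    (hφ : ContDiff ℝ (⊤ : ℕ∞) φ)
    (hinv : ∀ x y z : ℝ, φ (x + k, y, z) = φ (x, y, z) ∧
      φ (x, y + 1, z + x) = φ (x, y, z) ∧ φ (x, y, z + 1) = φ (x, y, z)) :
    min (distZ a (2 * Real.pi / k) ^ 2 + distZ b (2 * Real.pi) ^ 2)
        (2 * Real.pi) * (∫ p in heisF k, ‖φ p‖ ^ 2)
      ≤ ∫ p in heisF k,
          (‖heisX φ p + Complex.I * (a : ℂ) * φ p‖ ^ 2 +
            ‖heisY φ p + Complex.I * (b : ℂ) * φ p‖ ^ 2) := by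
  have hx : ∀ p, φ (p + ((k : ℝ), 0, 0)) = φ p := fun ⟨x, y, z⟩ => by
    simpa using (hinv x y z).1
  have hz : ∀ p, φ (p + (0, 0, 1)) = φ p := fun ⟨x, y, z⟩ => by
    simpa using (hinv x y z).2.2
  have htw : ∀ x y z, φ (x, y + 1, z + x) = φ (x, y, z) := fun x y z => (hinv x y z).2.1
  have hu := (contDiff_magX a hφ).continuous
  have hv := (contDiff_magY b hφ).continuous
  have hR := (hasSum_setIntegral_sq_norm_zCoeff k hu).add (hasSum_setIntegral_sq_norm_zCoeff k hv)
  rw [← integral_add (integrableOn_heisF (by fun_prop) k)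
    (integrableOn_heisF (by fun_prop) k)] at hR
  refine hasSum_le (fun m => ?_)
    ((hasSum_setIntegral_sq_norm_zCoeff k hφ.continuous).mul_left _) hR
  have hPm := continuous_zCoeff m hu
  have hQm := continuous_zCoeff m hv
  have hnonneg : 0 ≤ ∫ q in Set.Ioo (0 : ℝ) k ×ˢ Set.Ioo (0 : ℝ) 1, ‖zCoeff m φ q‖ ^ 2 :=
    integral_nonneg fun q => by positivity
  rw [← integral_add (integrableOn_Ioo_prod_Ioo (by fun_prop) _ _)
    (integrableOn_Ioo_prod_Ioo (by fun_prop) _ _)]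
  rcases eq_or_ne m 0 with rfl | hm
  · exact (mul_le_mul_of_nonneg_right (min_le_left _ _) hnonneg).trans
      (zCoeff_zero_rayleigh hk a b hφ hx hz htw)
  · exact (mul_le_mul_of_nonneg_right (min_le_right _ _) hnonneg).trans
      (zCoeff_rayleigh_of_ne_zero hm a b hφ hx hz htw)
end

section
/- Let m be a nonzero integer, k ≥ 1 an integer, and a, b ∈ ℝ. Let φ : ℝ³ → ℂ be smooth, Γ_k-invariant (i.e. φ(x+k,y,z) = φ(x,y+1,z+x) = φ(x,y,z+1) = φ(x,y,z)), and satisfy ∂_z φ = 2π i m φ everywhere. Then, with F = (0,k)×(0,1)×(0,1) and Lebesgue measure, ∫_F (|Xφ + i a φ|² + |Yφ + i b φ|²) ≥ 2π |m| ∫_F |φ|², where X φ = ∂_x φ + y ∂_z φ and Y φ = ∂_y φ. -/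
open MeasureTheory

/-- The Reeb vector field `Z = ∂_z` applied to `φ : ℝ³ → ℂ`. -/
noncomputable def heisZ (φ : ℝ × ℝ × ℝ → ℂ) (p : ℝ × ℝ × ℝ) : ℂ :=
  fderiv ℝ φ p (0, 0, 1)

/-- Leibniz rule for directional derivatives of `Im (conj f * g)`. -/
theorem hasFDerivAt_conj_mul_im {E : Type*} [NormedAddCommGroup E] [NormedSpace ℝ E]
    {f g : E → ℂ} {f' g' : E →L[ℝ] ℂ} {x : E} (hf : HasFDerivAt f f' x)
    (hg : HasFDerivAt g g' x) (w : E) :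
    fderiv ℝ (fun y => (starRingEnd ℂ (f y) * g y).im) x w =
      (starRingEnd ℂ (f' w) * g x + starRingEnd ℂ (f x) * g' w).im := by
  have h1 : HasFDerivAt (fun y => (f y).re * (g y).im - (f y).im * (g y).re) _ x :=
    ((Complex.reCLM.hasFDerivAt.comp x hf).mul (Complex.imCLM.hasFDerivAt.comp x hg)).sub
      ((Complex.imCLM.hasFDerivAt.comp x hf).mul (Complex.reCLM.hasFDerivAt.comp x hg))
  have h2 : (fun y => (starRingEnd ℂ (f y) * g y).im) =
      fun y => (f y).re * (g y).im - (f y).im * (g y).re := by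
    funext y; simp [Complex.mul_im]; ring
  rw [h2, h1.fderiv]
  simp [Complex.mul_im]
  ring

/-- The covariant derivative `∂_x + i (A y + a)`. -/
noncomputable def covX (A a : ℝ) (ψ : ℝ × ℝ → ℂ) (q : ℝ × ℝ) : ℂ :=
  fderiv ℝ ψ q (1, 0) + Complex.I * ((A * q.2 + a : ℝ) : ℂ) * ψ q

/-- The covariant derivative `∂_y + i b`. -/
noncomputable def covY (b : ℝ) (ψ : ℝ × ℝ → ℂ) (q : ℝ × ℝ) : ℂ :=
  fderiv ℝ ψ q (0, 1) + Complex.I * (b : ℂ) * ψ q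

theorem contDiff_covX {A a : ℝ} {ψ : ℝ × ℝ → ℂ} (hψ : ContDiff ℝ 2 ψ) :
    ContDiff ℝ 1 (covX A a ψ) := by
  have h1 : ContDiff ℝ 1 (fderiv ℝ ψ) := hψ.fderiv_right (by norm_num)
  have h2 : ContDiff ℝ 1 ψ := hψ.of_le (by norm_num)
  have h3 : ContDiff ℝ 1 (fun q : ℝ × ℝ => ((A * q.2 + a : ℝ) : ℂ)) :=
    Complex.ofRealCLM.contDiff.comp ((contDiff_snd.const_smul A).add contDiff_const)
  unfold covX
  fun_prop

theorem contDiff_covY {b : ℝ} {ψ : ℝ × ℝ → ℂ} (hψ : ContDiff ℝ 2 ψ) :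
    ContDiff ℝ 1 (covY b ψ) := by
  have h1 : ContDiff ℝ 1 (fderiv ℝ ψ) := hψ.fderiv_right (by norm_num)
  have h2 : ContDiff ℝ 1 ψ := hψ.of_le (by norm_num)
  unfold covY
  fun_prop

/-- The curvature identity `2 Im (conj (∇_X ψ) ∇_Y ψ) = ∂_x P - ∂_y Q + A |ψ|²`. -/
theorem divergence_current {A a b : ℝ} {ψ : ℝ × ℝ → ℂ} (hψ : ContDiff ℝ 2 ψ) (q : ℝ × ℝ) :
    fderiv ℝ (fun q => (starRingEnd ℂ (ψ q) * covY b ψ q).im) q (1, 0) +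
      fderiv ℝ (fun q => -(starRingEnd ℂ (ψ q) * covX A a ψ q).im) q (0, 1) =
    2 * (starRingEnd ℂ (covX A a ψ q) * covY b ψ q).im - A * ‖ψ q‖ ^ 2 := by
  have hD : ContDiff ℝ 1 (fderiv ℝ ψ) := hψ.fderiv_right (by norm_num)
  have h0 : HasFDerivAt ψ (fderiv ℝ ψ q) q := (hψ.differentiable (by norm_num) q).hasFDerivAt
  have hDD : HasFDerivAt (fderiv ℝ ψ) (fderiv ℝ (fderiv ℝ ψ) q) q :=
    (hD.differentiable (by norm_num) q).hasFDerivAt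
  have hsymm := (hψ.contDiffAt (x := q)).isSymmSndFDerivAt (by simp) (1, 0) (0, 1)
  have hA : HasFDerivAt (fun q : ℝ × ℝ => ((A * q.2 + a : ℝ) : ℂ)) _ q :=
    Complex.ofRealCLM.hasFDerivAt.comp q
      (((hasFDerivAt_snd (𝕜 := ℝ) (p := q)).const_mul A).add_const a)
  have hX : HasFDerivAt (covX A a ψ) _ q :=
    (hDD.clm_apply (hasFDerivAt_const ((1 : ℝ), (0 : ℝ)) q)).add ((hA.const_mul Complex.I).mul h0)
  have hY : HasFDerivAt (covY b ψ) _ q :=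
    (hDD.clm_apply (hasFDerivAt_const ((0 : ℝ), (1 : ℝ)) q)).add
      (h0.const_mul (Complex.I * (b : ℂ)))
  rw [fderiv_fun_neg, neg_apply, hasFDerivAt_conj_mul_im h0 hX,
    hasFDerivAt_conj_mul_im h0 hY]
  rw [Complex.sq_norm, Complex.normSq_apply]
  simp [covX, covY, hsymm, Complex.mul_im, Complex.mul_re]
  ring

theorem covY_periodic {b L : ℝ} {ψ : ℝ × ℝ → ℂ} (hper : ∀ x y, ψ (x + L, y) = ψ (x, y))
    (x y : ℝ) : covY b ψ (x + L, y) = covY b ψ (x, y) := by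
  have h : (fun q : ℝ × ℝ => ψ (q + (L, 0))) = ψ := by
    funext ⟨x, y⟩; simpa using hper x y
  have h2 := fderiv_comp_add_right (𝕜 := ℝ) (f := ψ) (x := (x, y)) (L, 0)
  rw [h] at h2
  simp only [Prod.mk_add_mk, add_zero] at h2
  simp [covY, h2, hper]

theorem covX_quasiperiodic {A a : ℝ} {ψ : ℝ × ℝ → ℂ} (hψ : Differentiable ℝ ψ)
    (hper : ∀ x y, ψ (x, y + 1) = Complex.exp (-(Complex.I * A * x)) * ψ (x, y))
    (x y : ℝ) :
    covX A a ψ (x, y + 1) = Complex.exp (-(Complex.I * A * x)) * covX A a ψ (x, y) := by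
  have h : (fun q : ℝ × ℝ => ψ (q + (0, 1))) =
      fun q => Complex.exp (-(Complex.I * A * q.1)) * ψ q := by
    funext ⟨x, y⟩; simpa using hper x y
  have h2 := fderiv_comp_add_right (𝕜 := ℝ) (f := ψ) (x := (x, y)) (0, 1)
  have h3 : HasFDerivAt (fun q : ℝ × ℝ => (q.1 : ℂ)) _ (x, y) :=
    Complex.ofRealCLM.hasFDerivAt.comp (x, y) hasFDerivAt_fst
  have h4 := (((h3.const_mul (Complex.I * A)).neg).cexp).mul (hψ (x, y)).hasFDerivAt
  rw [h] at h2
  replace h2 := h2.symm.trans h4.fderiv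
  simp only [Prod.mk_add_mk, add_zero] at h2
  simp [covX, h2, hper]
  ring

/-- The lowest Landau level bound for quasi-periodic functions on a rectangle. -/
theorem landau_rectangle {A a b L : ℝ} (hL : 0 ≤ L) {ψ : ℝ × ℝ → ℂ} (hψ : ContDiff ℝ 2 ψ)
    (hperx : ∀ x y, ψ (x + L, y) = ψ (x, y))
    (hpery : ∀ x y, ψ (x, y + 1) = Complex.exp (-(Complex.I * A * x)) * ψ (x, y)) :
    |A| * (∫ q in Set.Icc ((0 : ℝ), (0 : ℝ)) (L, 1), ‖ψ q‖ ^ 2) ≤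
      ∫ q in Set.Icc ((0 : ℝ), (0 : ℝ)) (L, 1), (‖covX A a ψ q‖ ^ 2 + ‖covY b ψ q‖ ^ 2) := by
  have hX := contDiff_covX (A := A) (a := a) hψ
  have hY := contDiff_covY (b := b) hψ
  have hψ1 : ContDiff ℝ 1 ψ := hψ.of_le (by norm_num)
  have him : ∀ {f g : ℝ × ℝ → ℂ}, ContDiff ℝ 1 f → ContDiff ℝ 1 g →
      ContDiff ℝ 1 (fun q => (starRingEnd ℂ (f q) * g q).im) := fun hf hg =>
    Complex.imCLM.contDiff.comp ((Complex.conjCLE.contDiff.comp hf).mul hg)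
  have hint : ∀ {f : ℝ × ℝ → ℝ}, Continuous f →
      IntegrableOn f (Set.Icc ((0 : ℝ), (0 : ℝ)) (L, 1)) := fun hf =>
    hf.continuousOn.integrableOn_compact isCompact_Icc
  have hP := him hψ1 hY
  have hQ := (him hψ1 hX).neg
  have hXc := hX.continuous
  have hYc := hY.continuous
  have hψc := hψ.continuous
  have hXYc := (him hX hY).continuous
  have hdiv := integral_divergence_prod_Icc_of_hasFDerivAt_of_le _ _ _ _
    ((0 : ℝ), (0 : ℝ)) (L, 1) ⟨hL, zero_le_one⟩ hP.continuous.continuousOn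
    hQ.continuous.continuousOn
    (fun q _ => (hP.differentiable (by norm_num) q).hasFDerivAt)
    (fun q _ => (hQ.differentiable (by norm_num) q).hasFDerivAt)
    (by simp only [divergence_current hψ]; exact hint (by fun_prop))
  have hPb : ∀ y, (starRingEnd ℂ (ψ (L, y)) * covY b ψ (L, y)).im =
      (starRingEnd ℂ (ψ (0, y)) * covY b ψ (0, y)).im := fun y => by
    have h1 := hperx 0 y
    have h2 := covY_periodic (b := b) hperx 0 y
    rw [zero_add] at h1 h2
    rw [h1, h2]
  have hQb : ∀ x, (starRingEnd ℂ (ψ (x, 1)) * covX A a ψ (x, 1)).im =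
      (starRingEnd ℂ (ψ (x, 0)) * covX A a ψ (x, 0)).im := fun x => by
    have h1 := hpery x 0
    have h2 := covX_quasiperiodic (a := a) (hψ.differentiable (by norm_num)) hpery x 0
    rw [zero_add] at h1 h2
    have h3 : starRingEnd ℂ (Complex.exp (-(Complex.I * A * x))) *
        Complex.exp (-(Complex.I * A * x)) = 1 := by
      rw [← Complex.exp_conj, ← Complex.exp_add]; simp
    rw [h1, h2, map_mul, mul_mul_mul_comm, h3, one_mul]
  simp only [divergence_current hψ, hPb, hQb, sub_self, zero_add] at hdiv
  rw [integral_sub (hint (by fun_prop)) (hint (by fun_prop)), integral_const_mul,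
    integral_const_mul, sub_eq_zero] at hdiv
  have hpt : ∀ u v : ℂ, |2 * (starRingEnd ℂ u * v).im| ≤ ‖u‖ ^ 2 + ‖v‖ ^ 2 := fun u v => by
    rw [Complex.sq_norm, Complex.sq_norm, Complex.normSq_apply, Complex.normSq_apply, abs_le]
    simp only [Complex.mul_im, Complex.conj_re, Complex.conj_im]
    constructor <;>
    nlinarith [sq_nonneg (u.re - v.im), sq_nonneg (u.im + v.re), sq_nonneg (u.re + v.im),
      sq_nonneg (u.im - v.re)]
  have hnn : 0 ≤ ∫ q in Set.Icc ((0 : ℝ), (0 : ℝ)) (L, 1), ‖ψ q‖ ^ 2 :=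
    integral_nonneg fun q => by positivity
  rw [← abs_of_nonneg hnn, ← abs_mul, ← hdiv, ← integral_const_mul]
  refine abs_integral_le_integral_abs.trans (integral_mono (hint (by fun_prop)) (hint (by fun_prop))
    fun q => hpt _ _)

/-- A function independent of the vertical variable integrates over `heisF k` to its integral over
the base rectangle. -/
theorem setIntegral_heisF_s8 (k : ℕ) (h : ℝ × ℝ → ℝ) :
    ∫ p in heisF k, h (p.1, p.2.1) = ∫ q in Set.Icc ((0 : ℝ), (0 : ℝ)) ((k : ℝ), 1), h q := by
  have e := (volume_preserving_prodAssoc (α₁ := ℝ) (β₁ := ℝ) (γ₁ := ℝ)).setIntegral_preimage_emb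
    MeasurableEquiv.prodAssoc.measurableEmbedding (fun p => h (p.1, p.2.1)) (heisF k)
  have hs : (MeasurableEquiv.prodAssoc : (ℝ × ℝ) × ℝ ≃ᵐ ℝ × ℝ × ℝ) ⁻¹' heisF k =
      (Set.Ioo (0 : ℝ) k ×ˢ Set.Ioo (0 : ℝ) 1) ×ˢ Set.Ioo (0 : ℝ) 1 := by
    ext ⟨⟨x, y⟩, z⟩
    simp [heisF, MeasurableEquiv.prodAssoc, and_assoc]
  rw [← e, hs]
  have hprod := setIntegral_prod_mul (μ := (volume : Measure (ℝ × ℝ))) (ν := (volume : Measure ℝ))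
    h (fun _ => (1 : ℝ)) (Set.Ioo (0 : ℝ) k ×ˢ Set.Ioo (0 : ℝ) 1) (Set.Ioo (0 : ℝ) 1)
  have hae : (Set.Ioo (0 : ℝ) k ×ˢ Set.Ioo (0 : ℝ) 1 : Set (ℝ × ℝ)) =ᵐ[volume]
      Set.Icc ((0 : ℝ), (0 : ℝ)) ((k : ℝ), 1) := by
    rw [Set.Icc_prod_eq]
    exact Measure.set_prod_ae_eq Ioo_ae_eq_Icc Ioo_ae_eq_Icc
  rw [← setIntegral_congr_set hae]
  simpa [MeasurableEquiv.prodAssoc, Measure.volume_eq_prod] using hprod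

/-- **Landau quantization on `Γ_k \ ℍ¹`.**  If `φ : ℝ³ → ℂ` is smooth,
`Γ_k`-invariant and lies in the `m`-th Fourier mode of the Reeb action
(`∂_z φ = 2πim φ`) with `m ≠ 0`, then
`∫_F (|Xφ + iaφ|² + |Yφ + ibφ|²) ≥ 2π|m| ∫_F |φ|²`. -/
theorem heisenberg_landau_level_lower_bound
    (m : ℤ) (hm : m ≠ 0) (k : ℕ) (hk : 1 ≤ k) (a b : ℝ)
    (φ : ℝ × ℝ × ℝ → ℂ) (hφ : ContDiff ℝ (⊤ : ℕ∞) φ)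
    (hinv : ∀ x y z : ℝ, φ (x + k, y, z) = φ (x, y, z) ∧
      φ (x, y + 1, z + x) = φ (x, y, z) ∧ φ (x, y, z + 1) = φ (x, y, z))
    (hmode : ∀ p, heisZ φ p = 2 * Real.pi * Complex.I * (m : ℂ) * φ p) :
    2 * Real.pi * |(m : ℝ)| * (∫ p in heisF k, ‖φ p‖ ^ 2)
      ≤ ∫ p in heisF k,
          (‖heisX φ p + Complex.I * (a : ℂ) * φ p‖ ^ 2 +
            ‖heisY φ p + Complex.I * (b : ℂ) * φ p‖ ^ 2) := by
  obtain ⟨A, hA⟩ : ∃ A : ℝ, A = 2 * Real.pi * m := ⟨_, rfl⟩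
  have hA' : 2 * Real.pi * |(m : ℝ)| = |A| := by
    rw [hA, abs_mul, abs_of_pos Real.two_pi_pos]
  replace hmode : ∀ p, heisZ φ p = Complex.I * A * φ p := fun p => by
    rw [hmode, hA]; push_cast; ring
  obtain ⟨ψ, hψdef⟩ : ∃ ψ : ℝ × ℝ → ℂ, ψ = fun q => φ (q.1, q.2, 0) := ⟨_, rfl⟩
  have hψ : ContDiff ℝ 2 ψ := by
    rw [hψdef]
    exact (contDiff_infty.mp hφ 2).comp (by fun_prop)
  have hdφ : Differentiable ℝ φ := hφ.differentiable (by simp)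
  have hfac : ∀ x y z : ℝ, φ (x, y, z) = Complex.exp (Complex.I * A * z) * ψ (x, y) := by
    intro x y z
    have hd : ∀ t : ℝ, HasDerivAt
        (fun t : ℝ => Complex.exp (-(Complex.I * A * t)) * φ (x, y, t)) 0 t := by
      intro t
      have h1 : HasDerivAt (fun t : ℝ => (x, y, t)) (0, 0, 1) t :=
        (hasDerivAt_const t x).prodMk ((hasDerivAt_const t y).prodMk (hasDerivAt_id t))
      have h2 := (hdφ (x, y, t)).hasFDerivAt.comp_hasDerivAt t h1
      have h3 := (((hasDerivAt_id t).ofReal_comp.const_mul (Complex.I * A)).neg.cexp).mul h2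
      refine h3.congr_deriv ?_
      have h4 := hmode (x, y, t)
      rw [heisZ] at h4
      rw [h4]
      simp
      ring
    have h5 := is_const_of_deriv_eq_zero (fun t => (hd t).differentiableAt)
      (fun t => (hd t).deriv) z 0
    simp only [Complex.ofReal_zero, mul_zero, neg_zero, Complex.exp_zero, one_mul] at h5
    rw [hψdef]
    simp only
    rw [← h5, ← mul_assoc, ← Complex.exp_add]
    simp
  have hnorm : ∀ z : ℝ, ‖Complex.exp (Complex.I * A * z)‖ = 1 := fun z => by
    rw [Complex.norm_exp]; simp
  have hmul : ∀ (z : ℝ) (w : ℂ), ‖Complex.exp (Complex.I * A * z) * w‖ = ‖w‖ := fun z w => by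
    rw [norm_mul, hnorm, one_mul]
  have hfd : ∀ x y z r s : ℝ, fderiv ℝ φ (x, y, z) (r, s, 0) =
      Complex.exp (Complex.I * A * z) * fderiv ℝ ψ (x, y) (r, s) := by
    intro x y z r s
    have h1 : HasFDerivAt (fun q : ℝ × ℝ => (q.1, q.2, z)) _ (x, y) :=
      (hasFDerivAt_fst (𝕜 := ℝ) (p := (x, y))).prodMk
        ((hasFDerivAt_snd (𝕜 := ℝ) (p := (x, y))).prodMk (hasFDerivAt_const z (x, y)))
    have h2 := (hdφ (x, y, z)).hasFDerivAt.comp (x, y) h1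
    have h3 := (hψ.differentiable (by norm_num) (x, y)).hasFDerivAt.const_mul
      (Complex.exp (Complex.I * A * z))
    have h4 : (φ ∘ fun q : ℝ × ℝ => (q.1, q.2, z)) =
        fun q => Complex.exp (Complex.I * A * z) * ψ q := by
      funext q; exact hfac q.1 q.2 z
    rw [h4] at h2
    simpa using congrArg (fun T => T (r, s)) (h2.unique h3)
  have hX : ∀ p, ‖heisX φ p + Complex.I * (a : ℂ) * φ p‖ = ‖covX A a ψ (p.1, p.2.1)‖ := by
    rintro ⟨x, y, z⟩
    have h1 := hmode (x, y, z)
    rw [heisZ] at h1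
    rw [heisX, h1, hfd, hfac, ← hmul z (covX A a ψ _), covX]
    congr 1
    simp only [Complex.real_smul]
    push_cast
    ring
  have hY : ∀ p, ‖heisY φ p + Complex.I * (b : ℂ) * φ p‖ = ‖covY b ψ (p.1, p.2.1)‖ := by
    rintro ⟨x, y, z⟩
    rw [heisY, hfd, hfac, ← hmul z (covY b ψ _), covY]
    congr 1
    ring
  have hφn : ∀ p, ‖φ p‖ = ‖ψ (p.1, p.2.1)‖ := by
    rintro ⟨x, y, z⟩
    rw [hfac, hmul]
  simp only [hX, hY, hφn, hA']
  rw [setIntegral_heisF_s8 k (fun q => ‖ψ q‖ ^ 2),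
    setIntegral_heisF_s8 k (fun q => ‖covX A a ψ q‖ ^ 2 + ‖covY b ψ q‖ ^ 2)]
  refine landau_rectangle k.cast_nonneg hψ (fun x y => ?_) (fun x y => ?_)
  · simpa [hψdef] using (hinv x y 0).1
  · have h1 := (hinv x y (-x)).2.1
    rw [neg_add_cancel, hfac x y (-x)] at h1
    rw [show ψ (x, y + 1) = φ (x, y + 1, 0) by rw [hψdef], h1]
    simp
end
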